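/- arXiv:1701.07730 — 3 statements merged into one kernel-verified Lean document; each statement's English description precedes it below -/
import Mathlib

section
/- Let K ≥ 1, let h : {1,…,K} → ℝ satisfy h_1 ≥ h_2 ≥ … ≥ h_K > 0, and let P > 0. For any family of nonnegative weights θ_J indexed by the nonempty subsets J ⊆ {1,…,K}, the supremum of Σ_{J} θ_J r_J over all r in the region Γ(h) equals the supremum, over all α ∈ ℝ_{≥0}^K with Σ_{k=1}^K α_k ≤ 1, of Σ_{k=1}^K θ̃_k · log( (1 + h_k P Σ_{j=1}^{k} α_j) / (1 + h_k P Σ_{j=1}^{k-1} α_j) ), where θ̃_k = max{ θ_J : k ∈ J ⊆ {1,…,k} }. -/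
open Finset

/-- The rate `C_k(α)` available to user `k` under power split `α`. -/
noncomputable def Ck {K : ℕ} (h : Fin K → ℝ) (P : ℝ) (α : Fin K → ℝ) (k : Fin K) : ℝ :=
  Real.log ((1 + h k * P * ∑ j ∈ Finset.univ.filter (fun j => j ≤ k), α j) /
            (1 + h k * P * ∑ j ∈ Finset.univ.filter (fun j => j < k), α j))

/-- The capacity region `Γ(h)` of the `K`-user degraded Gaussian broadcast channel, with
rate vectors represented as functions on subsets vanishing on `∅`. -/
noncomputable def Gamma {K : ℕ} (h : Fin K → ℝ) (P : ℝ) : Set (Finset (Fin K) → ℝ) :=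
  {r | (∀ J, 0 ≤ r J) ∧ r ∅ = 0 ∧
    ∃ α : Fin K → ℝ, (∀ k, 0 ≤ α k) ∧ (∑ k, α k ≤ 1) ∧
      ∀ k : Fin K,
        (∑ J ∈ Finset.univ.powerset.filter (fun J => k ∈ J ∧ ∀ j ∈ J, j ≤ k), r J)
          ≤ Ck h P α k}

lemma Ck_nonneg' {K : ℕ} (h : Fin K → ℝ) (hpos : ∀ k, 0 < h k) (P : ℝ) (hP : 0 < P)
    (α : Fin K → ℝ) (hα : ∀ k, 0 ≤ α k) (k : Fin K) : 0 ≤ Ck h P α k := by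
  unfold Ck
  have h1 : 0 ≤ ∑ j ∈ Finset.univ.filter (fun j => j < k), α j :=
    Finset.sum_nonneg (fun j _ => hα j)
  have h2 : ∑ j ∈ Finset.univ.filter (fun j => j < k), α j ≤
      ∑ j ∈ Finset.univ.filter (fun j => j ≤ k), α j := by
    apply Finset.sum_le_sum_of_subset_of_nonneg
    · intro j hj
      simp only [Finset.mem_filter, Finset.mem_univ, true_and] at hj ⊢
      exact hj.le
    · intro j _ _
      exact hα j
  have hp : 0 < h k * P := mul_pos (hpos k) hP
  apply Real.log_nonneg
  rw [one_le_div (by positivity)]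
  have := mul_le_mul_of_nonneg_left h2 hp.le
  linarith

lemma sum_by_max {K : ℕ} (f : Finset (Fin K) → ℝ) :
    ∑ J ∈ Finset.univ.powerset.filter (fun J : Finset (Fin K) => J.Nonempty), f J =
    ∑ k : Fin K, ∑ J ∈ Finset.univ.powerset.filter
      (fun J : Finset (Fin K) => k ∈ J ∧ ∀ j ∈ J, j ≤ k), f J := by
  simp_rw [Finset.sum_filter]
  rw [Finset.sum_comm]
  refine Finset.sum_congr rfl (fun J _ => ?_)
  split_ifs with hJ
  · rw [Finset.sum_eq_single (J.max' hJ)]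
    · rw [if_pos ⟨J.max'_mem hJ, fun j hj => J.le_max' j hj⟩]
    · intro k _ hk
      rw [if_neg]
      rintro ⟨h1, h2⟩
      exact hk (le_antisymm (J.le_max' k h1) (h2 _ (J.max'_mem hJ)))
    · simp
  · symm
    apply Finset.sum_eq_zero
    intro k _
    rw [if_neg]
    rintro ⟨h1, _⟩
    exact hJ ⟨k, h1⟩

/-- the weighted sum-rate maximization over `Γ(h)` with weights `θ_J ≥ 0`
reduces to the `K`-variable power-allocation problem with per-user weights
`θ̃_k = max{θ_J : k ∈ J ⊆ {1,…,k}}`. -/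
theorem weighted_sum_rate_reduction {K : ℕ} (hK : 1 ≤ K) (h : Fin K → ℝ)
    (hmono : ∀ i j : Fin K, i ≤ j → h j ≤ h i) (hpos : ∀ k, 0 < h k)
    (P : ℝ) (hP : 0 < P)
    (θ : Finset (Fin K) → ℝ) (hθ : ∀ J, 0 ≤ θ J)
    (θt : Fin K → ℝ)
    (hθt : ∀ k : Fin K,
      IsGreatest {x | ∃ J : Finset (Fin K), k ∈ J ∧ (∀ j ∈ J, j ≤ k) ∧ x = θ J} (θt k)) :
    sSup {x | ∃ r ∈ Gamma h P,
        x = ∑ J ∈ Finset.univ.powerset.filter (fun J => J.Nonempty), θ J * r J} =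
    sSup {x | ∃ α : Fin K → ℝ, (∀ k, 0 ≤ α k) ∧ (∑ k, α k ≤ 1) ∧
        x = ∑ k : Fin K, θt k * Ck h P α k} := by
  apply csSup_eq_csSup_of_forall_exists_le
  · rintro x ⟨r, ⟨hr0, -, α, hα, hs, hc⟩, rfl⟩
    refine ⟨_, ⟨α, hα, hs, rfl⟩, ?_⟩
    rw [sum_by_max]
    refine Finset.sum_le_sum (fun k _ => ?_)
    have ht : 0 ≤ θt k := by
      obtain ⟨J, _, _, e⟩ := (hθt k).1
      rw [e]
      exact hθ J
    refine le_trans ?_ (mul_le_mul_of_nonneg_left (hc k) ht)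
    rw [Finset.mul_sum]
    refine Finset.sum_le_sum (fun J hJ => ?_)
    have hJ' := (Finset.mem_filter.1 hJ).2
    exact mul_le_mul_of_nonneg_right ((hθt k).2 ⟨J, hJ'.1, hJ'.2, rfl⟩) (hr0 J)
  · rintro x ⟨α, hα, hs, rfl⟩
    choose Jf hm hle he using fun k => (hθt k).1
    refine ⟨_, ⟨fun J => ∑ i, if J = Jf i then Ck h P α i else 0,
      ⟨?_, ?_, α, hα, hs, ?_⟩, rfl⟩, ?_⟩
    · intro J
      refine Finset.sum_nonneg (fun i _ => ?_)
      split_ifs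
      · exact Ck_nonneg' h hpos P hP α hα i
      · exact le_rfl
    · refine Finset.sum_eq_zero (fun i _ => ?_)
      rw [if_neg]
      intro e
      have := hm i
      rw [← e] at this
      simp at this
    · intro k
      rw [Finset.sum_comm]
      simp_rw [Finset.sum_ite_eq']
      rw [Finset.sum_eq_single k]
      · split_ifs
        · exact le_rfl
        · exact Ck_nonneg' h hpos P hP α hα k
      · intro i _ hi
        rw [if_neg]
        intro hmem
        have h2 := (Finset.mem_filter.1 hmem).2
        exact hi (le_antisymm (h2.2 _ (hm i)) (hle i _ h2.1))
      · simp
    · simp_rw [Finset.mul_sum, mul_ite, mul_zero]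
      rw [Finset.sum_comm]
      simp_rw [Finset.sum_ite_eq']
      refine Finset.sum_le_sum (fun k _ => ?_)
      rw [if_pos, he k]
      simp only [Finset.mem_filter, Finset.powerset_univ, Finset.mem_univ, true_and]
      exact ⟨k, hm k⟩
end

section
/- Let K ≥ 1, let h : {1,…,K} → ℝ satisfy h_1 ≥ h_2 ≥ … ≥ h_K > 0, and let P > 0. Then the region Γ(h) is a convex subset of ℝ^{2^K−1}. -/
open Finset

lemma holder_aux (a b x y d : ℝ) (ha : 0 ≤ a) (hb : 0 ≤ b) (hab : a + b = 1)
    (hx : 0 < x) (hy : 0 < y) (hd : 0 ≤ d) :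
    x ^ a * y ^ b + d ≤ (x + d) ^ a * (y + d) ^ b := by
  have hxd : 0 < x + d := by linarith
  have hyd : 0 < y + d := by linarith
  have h1 := Real.geom_mean_le_arith_mean2_weighted ha hb
    (div_nonneg hx.le hxd.le) (div_nonneg hy.le hyd.le) hab
  have h2 := Real.geom_mean_le_arith_mean2_weighted ha hb
    (div_nonneg hd hxd.le) (div_nonneg hd hyd.le) hab
  have hs : (a * (x / (x + d)) + b * (y / (y + d))) + (a * (d / (x + d)) + b * (d / (y + d))) = 1 := by
    have e1 : x / (x + d) + d / (x + d) = 1 := by field_simp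
    have e2 : y / (y + d) + d / (y + d) = 1 := by field_simp
    linear_combination a * e1 + b * e2 + hab
  rw [Real.div_rpow hx.le hxd.le, Real.div_rpow hy.le hyd.le] at h1
  rw [Real.div_rpow hd hxd.le, Real.div_rpow hd hyd.le] at h2
  have hdd : d ^ a * d ^ b = d := by
    rw [← Real.rpow_add_of_nonneg hd ha hb, hab, Real.rpow_one]
  have hp : 0 < (x + d) ^ a := Real.rpow_pos_of_pos hxd _
  have hq : 0 < (y + d) ^ b := Real.rpow_pos_of_pos hyd _
  rw [div_mul_div_comm] at h1 h2
  rw [hdd] at h2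
  have h3 : (x ^ a * y ^ b + d) / ((x + d) ^ a * (y + d) ^ b) ≤ 1 := by
    rw [add_div]; linarith
  rwa [div_le_one (mul_pos hp hq)] at h3

lemma sum_lt_aux {K : ℕ} (G : ℕ → ℝ) (m : ℕ) (hm : m ≤ K) :
    ∑ j ∈ Finset.univ.filter (fun j : Fin K => j.val < m), (G (j.val + 1) - G j.val)
      = G m - G 0 := by
  rw [← Finset.sum_range_sub]
  refine Finset.sum_bij (fun j _ => j.val) ?_ ?_ ?_ ?_
  · intro j hj; simpa using hj
  · intro i _ j _ hij; exact Fin.ext hij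
  · intro i hi
    have : i < m := by simpa using hi
    exact ⟨⟨i, by omega⟩, by simpa using this, rfl⟩
  · intros; rfl

/-- partial sums -/
noncomputable def psum {K : ℕ} (α : Fin K → ℝ) (m : ℕ) : ℝ :=
  ∑ j ∈ Finset.univ.filter (fun j : Fin K => j.val < m), α j

lemma psum_mono {K : ℕ} (α : Fin K → ℝ) (hα : ∀ k, 0 ≤ α k) : Monotone (psum α) := by
  intro m n hmn
  refine Finset.sum_le_sum_of_subset_of_nonneg ?_ (fun i _ _ => hα i)
  intro j hj
  simp only [Finset.mem_filter, Finset.mem_univ, true_and] at hj ⊢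
  omega

lemma psum_zero {K : ℕ} (α : Fin K → ℝ) : psum α 0 = 0 := by simp [psum]

lemma psum_top {K : ℕ} (α : Fin K → ℝ) : psum α K = ∑ k, α k := by simp [psum]

lemma psum_nonneg {K : ℕ} (α : Fin K → ℝ) (hα : ∀ k, 0 ≤ α k) (m : ℕ) : 0 ≤ psum α m :=
  Finset.sum_nonneg (fun i _ => hα i)

lemma Ck_eq {K : ℕ} (h : Fin K → ℝ) (P : ℝ) (α : Fin K → ℝ) (k : Fin K) (hh : 0 < h k * P) :
    Ck h P α k = Real.log ((psum α (k.val + 1) + (h k * P)⁻¹) / (psum α k.val + (h k * P)⁻¹)) := by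
  have e1 : (∑ j ∈ Finset.univ.filter (fun j => j ≤ k), α j) = psum α (k.val + 1) := by
    unfold psum
    congr 1
    ext j
    simp only [Finset.mem_filter, Finset.mem_univ, true_and, Fin.le_def]
    omega
  have e2 : (∑ j ∈ Finset.univ.filter (fun j => j < k), α j) = psum α k.val := rfl
  have key : ∀ s : ℝ, 1 + h k * P * s = (h k * P) * (s + (h k * P)⁻¹) := by
    intro s; rw [mul_add, mul_inv_cancel₀ hh.ne']; ring
  unfold Ck
  rw [e1, e2, key, key, mul_div_mul_left _ _ hh.ne']

/-- for `h_1 ≥ … ≥ h_K > 0` and `P > 0`, the region `Γ(h)` is convex. -/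
theorem gamma_convex {K : ℕ} (hK : 1 ≤ K) (h : Fin K → ℝ)
    (hmono : ∀ i j : Fin K, i ≤ j → h j ≤ h i) (hpos : ∀ k, 0 < h k)
    (P : ℝ) (hP : 0 < P) :
    Convex ℝ (Gamma h P) := by
  rintro r ⟨hr0, hre, α, hα, hαs, hαC⟩ s ⟨hs0, hse, β, hβ, hβs, hβC⟩ a b ha hb hab
  refine ⟨fun J => ?_, ?_, ?_⟩
  · have := mul_nonneg ha (hr0 J)
    have := mul_nonneg hb (hs0 J)
    simp only [Pi.add_apply, Pi.smul_apply, smul_eq_mul]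
    linarith
  · simp [hre, hse]
  have hhP : ∀ k, 0 < h k * P := fun k => mul_pos (hpos k) hP
  set nn : ℕ → ℝ := fun m => if hm : m < K then (h ⟨m, hm⟩ * P)⁻¹ else 0 with hnn
  have nnk : ∀ k : Fin K, nn k.val = (h k * P)⁻¹ := fun k => by simp [hnn]
  have nnpos : ∀ k : Fin K, 0 < nn k.val := fun k => by
    rw [nnk]; exact inv_pos.mpr (hhP k)
  have nnmono : ∀ i j : Fin K, i ≤ j → nn i.val ≤ nn j.val := fun i j hij => by
    rw [nnk, nnk]
    exact inv_anti₀ (hhP j) (mul_le_mul_of_nonneg_right (hmono i j hij) hP.le)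
  set F : ℕ → ℝ → ℝ := fun m n => (psum α m + n) ^ a * (psum β m + n) ^ b with hF
  have Fpos : ∀ m n, 0 < n → 0 < F m n := fun m n hn => by
    have := psum_nonneg α hα m
    have := psum_nonneg β hβ m
    exact mul_pos (Real.rpow_pos_of_pos (by linarith) _) (Real.rpow_pos_of_pos (by linarith) _)
  have Fmono : ∀ m n, 0 < n → F m n ≤ F (m+1) n := fun m n hn => by
    have h1 := psum_nonneg α hα m
    have h2 := psum_nonneg β hβ m
    have h3 := psum_mono α hα (Nat.le_succ m)
    have h4 := psum_mono β hβ (Nat.le_succ m)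
    exact mul_le_mul (Real.rpow_le_rpow (by linarith) (by linarith) ha)
      (Real.rpow_le_rpow (by linarith) (by linarith) hb)
      (Real.rpow_nonneg (by linarith) _) (Real.rpow_nonneg (by linarith) _)
  have same : ∀ x : ℝ, 0 < x → x ^ a * x ^ b = x := fun x hx => by
    rw [← Real.rpow_add hx, hab, Real.rpow_one]
  let G : ℕ → ℝ := fun m => Nat.casesOn m 0 (fun i => F (i+1) (nn i) - nn i)
  have G0 : G 0 = 0 := rfl
  have GS : ∀ i, G (i+1) = F (i+1) (nn i) - nn i := fun i => rfl
  have Gle : ∀ k : Fin K, 0 < G k.val + nn k.val ∧ G k.val + nn k.val ≤ F k.val (nn k.val) := by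
    rintro ⟨k, hk⟩
    have hp := nnpos ⟨k, hk⟩
    dsimp only at hp ⊢
    cases k with
    | zero =>
      rw [G0, zero_add]
      refine ⟨hp, ?_⟩
      simp only [hF, psum_zero, zero_add]
      exact (same _ hp).ge
    | succ i =>
      have hi : i < K := by omega
      have hp' := nnpos ⟨i, hi⟩
      have hm := nnmono ⟨i, hi⟩ ⟨i+1, hk⟩ (by simp [Fin.le_def])
      dsimp only at hp' hm
      rw [GS]
      refine ⟨by linarith [Fpos (i+1) (nn i) hp'], ?_⟩
      have h1 := psum_nonneg α hα (i+1)
      have h2 := psum_nonneg β hβ (i+1)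
      have := holder_aux a b (psum α (i+1) + nn i) (psum β (i+1) + nn i) (nn (i+1) - nn i)
        ha hb hab (by linarith) (by linarith) (by linarith)
      have e1 : psum α (i+1) + nn i + (nn (i+1) - nn i) = psum α (i+1) + nn (i+1) := by ring
      have e2 : psum β (i+1) + nn i + (nn (i+1) - nn i) = psum β (i+1) + nn (i+1) := by ring
      rw [e1, e2] at this
      simp only [hF]
      linarith
  have psG : ∀ m ≤ K, psum (fun j : Fin K => G (j.val + 1) - G j.val) m = G m := fun m hm => by
    have := sum_lt_aux (K := K) G m hm
    rw [G0, sub_zero] at this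
    exact this
  refine ⟨fun j => G (j.val + 1) - G j.val, fun k => ?_, ?_, fun k => ?_⟩
  · have h1 := (Gle k).2
    have h2 := Fmono k.val _ (nnpos k)
    show 0 ≤ G (k.val + 1) - G k.val
    rw [GS]; linarith
  · rw [← psum_top, psG K le_rfl]
    obtain ⟨i, rfl⟩ : ∃ i, K = i + 1 := ⟨K - 1, by omega⟩
    have hp := nnpos ⟨i, by omega⟩
    dsimp only at hp
    rw [GS]
    simp only [hF]
    rw [psum_top, psum_top]
    have h1 : 0 ≤ ∑ k, α k := Finset.sum_nonneg (fun i _ => hα i)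
    have h2 : 0 ≤ ∑ k, β k := Finset.sum_nonneg (fun i _ => hβ i)
    have h3 := same (1 + nn i) (by linarith)
    have h4 : (∑ k, α k + nn i) ^ a * (∑ k, β k + nn i) ^ b ≤ (1 + nn i) ^ a * (1 + nn i) ^ b :=
      mul_le_mul (Real.rpow_le_rpow (by linarith) (by linarith) ha)
        (Real.rpow_le_rpow (by linarith) (by linarith) hb)
        (Real.rpow_nonneg (by linarith) _) (Real.rpow_nonneg (by linarith) _)
    linarith
  · have hA := hαC k
    have hB := hβC k
    rw [Ck_eq h P _ k (hhP k), ← nnk] at hA hB ⊢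
    rw [psG _ k.isLt, psG _ k.isLt.le]
    have hp := nnpos k
    obtain ⟨g1, g2⟩ := Gle k
    have a1 := psum_nonneg α hα k.val
    have a2 := psum_nonneg α hα (k.val + 1)
    have b1 := psum_nonneg β hβ k.val
    have b2 := psum_nonneg β hβ (k.val + 1)
    have lF : ∀ m, Real.log (F m (nn k.val)) =
        a * Real.log (psum α m + nn k.val) + b * Real.log (psum β m + nn k.val) := fun m => by
      have := psum_nonneg α hα m
      have := psum_nonneg β hβ m
      have p1 : 0 < psum α m + nn k.val := by linarith
      have p2 : 0 < psum β m + nn k.val := by linarith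
      simp only [hF]
      rw [Real.log_mul (Real.rpow_pos_of_pos p1 _).ne' (Real.rpow_pos_of_pos p2 _).ne',
        Real.log_rpow p1, Real.log_rpow p2]
    have eG : G (k.val + 1) + nn k.val = F (k.val + 1) (nn k.val) := by rw [GS]; ring
    rw [eG, Real.log_div (Fpos _ _ hp).ne' g1.ne', lF]
    have hl := Real.log_le_log g1 g2
    rw [lF] at hl
    rw [Real.log_div (by linarith) (by linarith)] at hA hB
    simp only [Pi.add_apply, Pi.smul_apply, smul_eq_mul, Finset.sum_add_distrib, ← Finset.mul_sum]
    have hA' := mul_le_mul_of_nonneg_left hA ha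
    have hB' := mul_le_mul_of_nonneg_left hB hb
    linarith
end

section
/- Let K ≥ 1, let h_1 > h_2 > … > h_K > 0, let θ_k > 0 for k = 1,…,K, and let P > 0. Let λ > 0 be the unique solution of max_{1 ≤ k ≤ K} ( θ_k/λ − 1/h_k ) = P. For z ≥ 0 define u_k(z) = θ_k/(1/h_k + z) − λ, and set α*_k = (1/P) · Leb( { z ≥ 0 : u_k(z) = max_{1 ≤ j ≤ K} u_j(z) and u_k(z) ≥ 0 } ), where Leb denotes Lebesgue measure. Then α*_k ≥ 0 for all k, Σ_{k=1}^K α*_k = 1, and α* maximizes f(α) = Σ_{k=1}^K θ_k · log( (1 + h_k P Σ_{j=1}^{k} α_j) / (1 + h_k P Σ_{j=1}^{k-1} α_j) ) over all α ∈ ℝ_{≥0}^K with Σ_{k=1}^K α_k ≤ 1. -/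
open Finset MeasureTheory

lemma wf_tele {K : ℕ} (F : ℝ → ℝ) (α : Fin K → ℝ) :
    ∑ k : Fin K, (F (∑ j ∈ Finset.univ.filter (fun j => j ≤ k), α j) -
      F (∑ j ∈ Finset.univ.filter (fun j => j < k), α j)) = F (∑ k, α k) - F 0 := by
  have key := Finset.sum_range_sub
    (fun n : ℕ => F (∑ j ∈ Finset.univ.filter (fun j : Fin K => j.val < n), α j)) K
  rw [Finset.sum_range] at key
  have e1 : (Finset.univ.filter (fun j : Fin K => j.val < K)) = Finset.univ := by
    ext j; simp
  have e2 : (Finset.univ.filter (fun j : Fin K => j.val < 0)) = ∅ := by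
    ext j; simp
  rw [e1, e2, Finset.sum_empty] at key
  rw [← key]
  refine Finset.sum_congr rfl fun k _ => ?_
  simp only [Order.lt_add_one_iff, Fin.val_fin_le, Fin.val_fin_lt]

noncomputable def wfg {K : ℕ} (h θ : Fin K → ℝ) (k : Fin K) (z : ℝ) : ℝ :=
  θ k / (1 / h k + max z 0)

lemma wfg_cont {K : ℕ} (h θ : Fin K → ℝ) (hpos : ∀ k, 0 < h k) (k : Fin K) :
    Continuous (wfg h θ k) := by
  unfold wfg
  refine Continuous.div (by fun_prop) (by fun_prop) fun z => ?_
  have := hpos k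
  have : 0 ≤ max z 0 := le_max_right _ _
  positivity

lemma wfg_int {K : ℕ} (h θ : Fin K → ℝ) (hpos : ∀ k, 0 < h k) (k : Fin K) (a b : ℝ)
    (ha : 0 ≤ a) (hab : a ≤ b) :
    ∫ z in a..b, wfg h θ k z = θ k * Real.log ((1 + h k * b) / (1 + h k * a)) := by
  have hk := hpos k
  have hb := ha.trans hab
  have : ∀ z ∈ Set.uIcc a b, HasDerivAt (fun z => θ k * Real.log (1 + h k * z)) (wfg h θ k z) z := by
    intro z hz
    rw [Set.uIcc_of_le hab] at hz
    have hz0 : 0 ≤ z := ha.trans hz.1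
    have hne : 1 + h k * z ≠ 0 := by positivity
    have h1 : HasDerivAt (fun z => 1 + h k * z) (h k) z := by
      simpa using ((hasDerivAt_id z).const_mul (h k)).const_add 1
    have h2 := (h1.log hne).const_mul (θ k)
    have e : wfg h θ k z = θ k * (h k / (1 + h k * z)) := by
      unfold wfg
      rw [max_eq_left hz0]
      field_simp
    rw [e]
    exact h2
  rw [intervalIntegral.integral_eq_sub_of_hasDerivAt this
    ((wfg_cont h θ hpos k).intervalIntegrable _ _)]
  rw [Real.log_div (by positivity) (by positivity)]
  ring

lemma wf_lower (T : Set ℝ) (h0 : ∀ z ∈ T, 0 ≤ z) (hl : ∀ z ∈ T, ∀ y, 0 ≤ y → y ≤ z → y ∈ T)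
    (hfin : volume T ≠ ⊤) (z : ℝ) (hz : 0 ≤ z) :
    (z < (volume T).toReal → z ∈ T) ∧ (z ∈ T → z ≤ (volume T).toReal) := by
  constructor
  · intro hlt
    by_contra hn
    have hsub : T ⊆ Set.Icc 0 z := fun y hy => ⟨h0 y hy, by
      by_contra hc
      exact hn (hl y hy z hz (not_le.1 hc).le)⟩
    have := ENNReal.toReal_mono (by simp) (measure_mono (μ := volume) hsub)
    simp [hz] at this
    linarith
  · intro hm
    have hsub : Set.Icc 0 z ⊆ T := fun y hy => hl z hm y hy.1 hy.2
    have := ENNReal.toReal_mono hfin (measure_mono (μ := volume) hsub)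
    simpa [hz] using this

/-- optimality of the marginal-utility (water-filling) power allocation.
With `h_1 > … > h_K > 0`, `θ_k > 0`, `P > 0`, `λ > 0` the unique solution of
`max_k (θ_k/λ − 1/h_k) = P`, utilities `u_k(z) = θ_k/(1/h_k + z) − λ`, and
`α*_k = Leb({z ≥ 0 : u_k(z) = max_j u_j(z), u_k(z) ≥ 0})/P`, the vector `α*` is a
point of the simplex with `Σ_k α*_k = 1` maximizing `f(α) = Σ_k θ_k · Ck(α)_k`. -/
theorem waterfilling_optimal {K : ℕ} (hK : 1 ≤ K)
    (h θ : Fin K → ℝ)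
    (hdec : ∀ i j : Fin K, i < j → h j < h i) (hpos : ∀ k, 0 < h k)
    (hθ : ∀ k, 0 < θ k) (P : ℝ) (hP : 0 < P)
    (lam : ℝ) (hlam : 0 < lam)
    (hlamSol : IsGreatest {x | ∃ k : Fin K, x = θ k / lam - 1 / h k} P)
    (u : Fin K → ℝ → ℝ) (hu : ∀ k z, u k z = θ k / (1 / h k + z) - lam)
    (αstar : Fin K → ℝ)
    (hαstar : ∀ k, αstar k =
      (volume {z : ℝ | 0 ≤ z ∧ (∀ j, u j z ≤ u k z) ∧ 0 ≤ u k z}).toReal / P) :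
    (∀ k, 0 ≤ αstar k) ∧ (∑ k, αstar k = 1) ∧
    (∀ α : Fin K → ℝ, (∀ k, 0 ≤ α k) → (∑ k, α k ≤ 1) →
      (∑ k, θ k * Ck h P α k) ≤ ∑ k, θ k * Ck h P αstar k) := by
  have : Nonempty (Fin K) := ⟨⟨0, hK⟩⟩
  set S : Fin K → Set ℝ := fun k => {z : ℝ | 0 ≤ z ∧ (∀ j, u j z ≤ u k z) ∧ 0 ≤ u k z} with hS
  have hug : ∀ k z, 0 ≤ z → u k z = wfg h θ k z - lam := by
    intro k z hz
    rw [hu, wfg, max_eq_left hz]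
  have hgc := wfg_cont h θ hpos
  -- positivity of utility
  have hu0 : ∀ k z, 0 ≤ z → (0 ≤ u k z ↔ z ≤ θ k / lam - 1 / h k) := by
    intro k z hz
    have hk := hpos k
    have hd : 0 < 1 / h k + z := by positivity
    rw [hu, sub_nonneg, le_div_iff₀ hd, le_sub_iff_add_le, le_div_iff₀ hlam]
    constructor <;> intro H <;> nlinarith
  -- crossing
  have hcross : ∀ j i, j < i → ∀ y z, 0 ≤ y → y < z → u i z ≤ u j z → u i y < u j y := by
    intro j i hji y z hy hyz hle
    have hj := hpos j
    have hi := hpos i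
    have hh := hdec j i hji
    have hn : 1 / h j < 1 / h i := one_div_lt_one_div_of_lt hi hh
    have hnj : 0 < 1 / h j := by positivity
    have hti := hθ i
    have htj := hθ j
    simp only [hu] at hle ⊢
    have hle' : θ i / (1 / h i + z) ≤ θ j / (1 / h j + z) := by linarith
    rw [sub_lt_sub_iff_right]
    generalize 1 / h j = a at *
    generalize 1 / h i = b at *
    rw [div_le_div_iff₀ (by linarith) (by linarith)] at hle'
    rw [div_lt_div_iff₀ (by linarith) (by linarith)]
    by_contra hc
    push Not at hc
    have hz1 : 0 < a + y := by linarith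
    have hz2 : 0 < a + z := by linarith
    have hz3 : 0 < b + y := by linarith
    have hz4 : 0 < b + z := by linarith
    have m1 := mul_le_mul hle' hc (by positivity) (by positivity)
    have m2 : 0 < (θ i * θ j) * ((b - a) * (z - y)) := by
      have : 0 < b - a := by linarith
      have : 0 < z - y := by linarith
      positivity
    nlinarith
  have hS0 : ∀ k, ∀ z ∈ S k, 0 ≤ z := fun k z hz => hz.1
  have hSP : ∀ k, S k ⊆ Set.Icc 0 P := by
    intro k z hz
    exact ⟨hz.1, ((hu0 k z hz.1).1 hz.2.2).trans (hlamSol.2 ⟨k, rfl⟩)⟩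
  have hcov : ∀ z, 0 ≤ z → z ≤ P → ∃ k, z ∈ S k := by
    intro z hz hzP
    obtain ⟨k, hk⟩ := Finite.exists_max (fun k => u k z)
    obtain ⟨k0, hk0⟩ := hlamSol.1
    refine ⟨k, hz, hk, le_trans ?_ (hk k0)⟩
    rw [hu0 k0 z hz]; linarith
  have hSmeas : ∀ k, MeasurableSet (S k) := by
    intro k
    have e : S k = Set.Ici 0 ∩ ((⋂ j, {z | wfg h θ j z ≤ wfg h θ k z}) ∩ {z | lam ≤ wfg h θ k z}) := by
      ext z
      simp only [hS, Set.mem_ofPred_eq, Set.mem_inter_iff, Set.mem_Ici, Set.mem_iInter]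
      refine and_congr_right fun hz => ?_
      simp only [hug _ z hz]
      simp
    rw [e]
    refine (isClosed_Ici.inter ((isClosed_iInter fun j => isClosed_le (hgc j) (hgc k)).inter
      (isClosed_le continuous_const (hgc k)))).measurableSet
  have hpre : ∀ i j, i < j → volume (S i ∩ S j) = 0 := by
    intro i j hij
    apply Set.Subsingleton.measure_zero
    intro x hx y hy
    by_contra hne
    rcases lt_or_gt_of_ne hne with hl | hl
    · exact absurd (hx.2.2.1 i) (not_le.2 (hcross i j hij x y hx.1.1 hl (hy.1.2.1 j)))
    · exact absurd (hy.2.2.1 i) (not_le.2 (hcross i j hij y x hy.1.1 hl (hx.1.2.1 j)))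
  have hdisj : Pairwise (fun i j => AEDisjoint volume (S i) (S j)) := by
    intro i j hij
    rcases lt_or_gt_of_ne hij with hl | hl
    · exact hpre i j hl
    · exact AEDisjoint.symm (hpre j i hl)
  have hfin : ∀ k, volume (S k) ≠ ⊤ := fun k =>
    ne_top_of_le_ne_top (by simp) (measure_mono (μ := volume) (hSP k))
  have hsum : ∀ A : Finset (Fin K), P * ∑ k ∈ A, αstar k = (volume (⋃ k ∈ A, S k)).toReal := by
    intro A
    rw [measure_biUnion_finset₀ (fun i _ j _ hij => hdisj hij)
      (fun k _ => (hSmeas k).nullMeasurableSet), ENNReal.toReal_sum (fun k _ => hfin k),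
      Finset.mul_sum]
    refine Finset.sum_congr rfl fun k _ => ?_
    rw [hαstar k]; field_simp
    rfl
  have hα0 : ∀ k, 0 ≤ αstar k := fun k => by rw [hαstar k]; positivity
  have hα1 : ∑ k, αstar k = 1 := by
    have h1 := hsum Finset.univ
    have e : (⋃ k ∈ (Finset.univ : Finset (Fin K)), S k) = Set.Icc 0 P := by
      ext z
      simp only [Finset.mem_univ, Set.iUnion_true, Set.mem_iUnion]
      exact ⟨fun ⟨k, hk⟩ => hSP k hk, fun hz => hcov z hz.1 hz.2⟩
    rw [e] at h1
    simp [hP.le] at h1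
    have : P * ∑ k, αstar k = P * 1 := by linarith
    exact mul_left_cancel₀ hP.ne' this
  refine ⟨hα0, hα1, ?_⟩
  -- lower sets
  have hlow : ∀ A : Finset (Fin K), (∀ i j, i ≤ j → j ∈ A → i ∈ A) → ∀ z, 0 ≤ z →
      (z < P * ∑ k ∈ A, αstar k → z ∈ ⋃ k ∈ A, S k) ∧
      (z ∈ (⋃ k ∈ A, S k) → z ≤ P * ∑ k ∈ A, αstar k) := by
    intro A hA z hz
    rw [hsum A]
    refine wf_lower _ ?_ ?_ ?_ z hz
    · intro z hz
      simp only [Set.mem_iUnion] at hz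
      obtain ⟨k, _, hk⟩ := hz
      exact hk.1
    · intro z hz y hy hyz
      simp only [Set.mem_iUnion] at hz ⊢
      obtain ⟨k, hkA, hk⟩ := hz
      rcases eq_or_lt_of_le hyz with rfl | hlt
      · exact ⟨k, hkA, hk⟩
      obtain ⟨i, hi⟩ := hcov y hy (hyz.trans (hSP k hk).2)
      refine ⟨i, hA i k ?_ hkA, hi⟩
      by_contra hc
      exact absurd (hi.2.1 k) (not_le.2 (hcross k i (not_le.1 hc) y z hy hlt (hk.2.1 i)))
    · refine ne_top_of_le_ne_top (b := volume (Set.Icc 0 P)) (by simp) (measure_mono ?_)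
      exact Set.iUnion₂_subset fun k _ => hSP k
  set M : ℝ → ℝ := fun z => Finset.univ.sup' Finset.univ_nonempty (fun k => wfg h θ k z) with hM
  have hMc : Continuous M := by
    refine Continuous.finset_sup'_apply _ fun k _ => hgc k
  have hgM : ∀ k z, wfg h θ k z ≤ M z := fun k z =>
    Finset.le_sup' (fun k => wfg h θ k z) (Finset.mem_univ k)
  have hM0 : ∀ z, 0 ≤ M z := by
    intro z
    refine le_trans ?_ (hgM (Classical.arbitrary _) z)
    unfold wfg
    have := hpos (Classical.arbitrary (Fin K))
    have := hθ (Classical.arbitrary (Fin K))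
    have : 0 ≤ max z 0 := le_max_right _ _
    positivity
  have hMi : ∀ a b, IntervalIntegrable M volume a b := fun a b => hMc.intervalIntegrable a b
  set F : ℝ → ℝ := fun t => ∫ z in (0:ℝ)..(P * t), M z with hF
  have hF0 : F 0 = 0 := by simp [hF]
  have hFs : ∀ a b, F b - F a = ∫ z in (P * a)..(P * b), M z := fun a b =>
    intervalIntegral.integral_interval_sub_left (hMi _ _) (hMi _ _)
  have hbd : ∀ α : Fin K → ℝ, (∀ k, 0 ≤ α k) → ∀ k,
      0 ≤ P * (∑ j ∈ Finset.univ.filter (fun j => j < k), α j) ∧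
      P * (∑ j ∈ Finset.univ.filter (fun j => j < k), α j) ≤
        P * (∑ j ∈ Finset.univ.filter (fun j => j ≤ k), α j) := by
    intro α hα k
    refine ⟨mul_nonneg hP.le (Finset.sum_nonneg fun j _ => hα j),
      mul_le_mul_of_nonneg_left (Finset.sum_le_sum_of_subset_of_nonneg ?_ fun j _ _ => hα j) hP.le⟩
    intro j
    simp only [Finset.mem_filter, Finset.mem_univ, true_and]
    exact le_of_lt
  have hC : ∀ α : Fin K → ℝ, (∀ k, 0 ≤ α k) → ∀ k, θ k * Ck h P α k =
      ∫ z in (P * (∑ j ∈ Finset.univ.filter (fun j => j < k), α j))..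
        (P * (∑ j ∈ Finset.univ.filter (fun j => j ≤ k), α j)), wfg h θ k z := by
    intro α hα k
    rw [wfg_int h θ hpos k _ _ (hbd α hα k).1 (hbd α hα k).2, Ck]
    simp only [mul_assoc]
  have hstar : ∑ k, θ k * Ck h P αstar k = F 1 := by
    have := wf_tele F αstar
    rw [hα1, hF0, sub_zero] at this
    rw [← this]
    refine Finset.sum_congr rfl fun k _ => ?_
    rw [hC αstar hα0, hFs]
    have hb := hbd αstar hα0 k
    rw [intervalIntegral.integral_of_le hb.2, intervalIntegral.integral_of_le hb.2,
      integral_Ioc_eq_integral_Ioo, integral_Ioc_eq_integral_Ioo]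
    refine setIntegral_congr_fun measurableSet_Ioo fun z hz => ?_
    have hz0 : 0 ≤ z := hb.1.trans hz.1.le
    have h1 := (hlow (Finset.univ.filter (fun j => j ≤ k)) (by
      intro i j hij; simp only [Finset.mem_filter, Finset.mem_univ, true_and]
      exact hij.trans) z hz0).1 hz.2
    have h2 : z ∉ ⋃ j ∈ Finset.univ.filter (fun j => j < k), S j := fun hc =>
      absurd ((hlow (Finset.univ.filter (fun j => j < k)) (by
      intro i j hij; simp only [Finset.mem_filter, Finset.mem_univ, true_and]
      exact hij.trans_lt) z hz0).2 hc) (not_le.2 hz.1)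
    simp only [Set.mem_iUnion, Finset.mem_filter, Finset.mem_univ, true_and, not_exists] at h1 h2
    obtain ⟨i, hik, hi⟩ := h1
    have : i = k := by
      rcases eq_or_lt_of_le hik with e | hl
      · exact e
      · exact absurd hi (h2 i hl)
    subst this
    refine le_antisymm (hgM i z) (Finset.sup'_le _ _ fun j _ => ?_)
    have := hi.2.1 j
    rw [hug _ z hz0, hug _ z hz0] at this
    linarith
  intro α hα hα1'
  rw [hstar]
  calc ∑ k, θ k * Ck h P α k ≤ ∑ k : Fin K, (F (∑ j ∈ Finset.univ.filter (fun j => j ≤ k), α j) -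
      F (∑ j ∈ Finset.univ.filter (fun j => j < k), α j)) := by
        refine Finset.sum_le_sum fun k _ => ?_
        rw [hC α hα, hFs]
        exact intervalIntegral.integral_mono_on (hbd α hα k).2 ((hgc k).intervalIntegrable _ _)
          (hMi _ _) fun z _ => hgM k z
    _ = F (∑ k, α k) := by rw [wf_tele, hF0, sub_zero]
    _ ≤ F 1 := by
        rw [← sub_nonneg, hFs]
        exact intervalIntegral.integral_nonneg (mul_le_mul_of_nonneg_left hα1' hP.le)
          fun z _ => hM0 z
end
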